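/- arXiv:1411.6340 — 3 statements merged into one kernel-verified Lean document; each statement's English description precedes it below -/
import Mathlib

section
/- Let 𝒳 be a set, D ⊆ ℝ, and for each i ∈ {1,…,k} let f_i : 𝒳 → D be an arbitrary function and h_i : D → ℝ a concave function, and define the cost C_h(x) = ∑_{i=1}^k h_i(f_i(x)). Suppose (x^t)_{t∈ℕ} is a sequence in 𝒳 such that for every t, choosing for each i a supergradient w_i^t of h_i at f_i(x^t), the iterate x^{t+1} satisfies ∑_{i=1}^k w_i^t · f_i(x^{t+1}) ≤ ∑_{i=1}^k w_i^t · f_i(x^t). Then the sequence of cost values (C_h(x^t))_{t∈ℕ} is non-increasing, i.e. C_h(x^{t+1}) ≤ C_h(x^t) for all t. -/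
/-- If `w i` satisfies the supergradient inequality of `h i` at `a i` towards `b i`, and the
weighted sum does not increase from `a` to `b`, then neither does `∑ i ∈ s, h i`. -/
theorem sum_comp_le_of_supergradient {ι : Type*} (s : Finset ι) {h : ι → ℝ → ℝ} {a b w : ι → ℝ}
    (hw : ∀ i ∈ s, h i (b i) ≤ h i (a i) + (b i - a i) * w i)
    (hdec : ∑ i ∈ s, w i * b i ≤ ∑ i ∈ s, w i * a i) :
    ∑ i ∈ s, h i (b i) ≤ ∑ i ∈ s, h i (a i) := by
  have hsum := Finset.sum_le_sum hw
  have hlin : ∑ i ∈ s, (b i - a i) * w i = ∑ i ∈ s, w i * b i - ∑ i ∈ s, w i * a i := by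
    rw [← Finset.sum_sub_distrib]
    exact Finset.sum_congr rfl fun i _ => by ring
  rw [Finset.sum_add_distrib, hlin] at hsum
  linarith

/-- Monotone-decrease guarantee of iteratively reweighted minimization (Algorithm 1):
if at every iteration `t` the weights `w t i` are supergradients of `h i` at `f i (xs t)`,
and the next iterate does not increase the weighted surrogate cost, then the true cost
`C_h (xs t) = ∑ i, h i (f i (xs t))` is non-increasing in `t`. -/
theorem stmt_4 {X : Type*} (D : Set ℝ) (k : ℕ) (f : Fin k → X → ℝ) (h : Fin k → ℝ → ℝ)
    (hf : ∀ i y, f i y ∈ D)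
    (hconc : ∀ i, ConcaveOn ℝ D (h i))
    (xs : ℕ → X) (w : ℕ → Fin k → ℝ)
    (hw : ∀ t i, ∀ d ∈ D, h i d ≤ h i (f i (xs t)) + (d - f i (xs t)) * w t i)
    (hdec : ∀ t, ∑ i, w t i * f i (xs (t + 1)) ≤ ∑ i, w t i * f i (xs t)) :
    ∀ t, ∑ i, h i (f i (xs (t + 1))) ≤ ∑ i, h i (f i (xs t)) := by
  intro t
  exact sum_comp_le_of_supergradient Finset.univ (fun i _ => hw t i _ (hf i _)) (hdec t)
end

section
/- Let λ ≥ 0 and let θ : [0,∞) → ℝ be a non-decreasing function that is convex on [0, λ] and concave on [λ, ∞), with left derivative θ'(λ) at λ assumed to exist, be finite, and be strictly positive. Define g(z) = θ(z) for z ≤ λ and g(z) = θ'(λ)·(z − λ) + θ(λ) for z ≥ λ, and define h_b(y) = y for y ≤ θ(λ) and h_b(y) = θ((y + λ·θ'(λ) − θ(λ)) / θ'(λ)) for y ≥ θ(λ). Then for every z ∈ [0,∞), h_b(g(z)) = θ(z). -/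
/-- Table 1 decomposition: with `g` and `h_b` as in Table 1 (built from a non-decreasing `θ`
that is convex on `[0,λ]` and concave on `[λ,∞)`, with strictly positive left derivative
`dλ` at `λ`), one has `h_b (g z) = θ z` for every `z ≥ 0`. -/
theorem stmt_11 (lam : ℝ) (hlam : 0 ≤ lam) (θ : ℝ → ℝ)
    (hmono : MonotoneOn θ (Set.Ici 0))
    (hconv : ConvexOn ℝ (Set.Icc 0 lam) θ)
    (hconc : ConcaveOn ℝ (Set.Ici lam) θ)
    (dlam : ℝ) (hder : HasDerivWithinAt θ dlam (Set.Icc 0 lam) lam) (hdpos : 0 < dlam)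
    (g hb : ℝ → ℝ)
    (hg : ∀ z, g z = if z ≤ lam then θ z else dlam * (z - lam) + θ lam)
    (hhb : ∀ y, hb y = if y ≤ θ lam then y else θ ((y + lam * dlam - θ lam) / dlam)) :
    ∀ z, 0 ≤ z → hb (g z) = θ z := by
  intro z hz
  rw [hg, hhb]
  by_cases h : z ≤ lam
  · have hle : θ z ≤ θ lam := hmono hz hlam h
    rw [if_pos h, if_pos hle]
  · have hpos : 0 < dlam * (z - lam) := mul_pos hdpos (by linarith)
    rw [if_neg h, if_neg (by linarith)]
    congr 1
    field_simp
    ring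
end

section
/- Let 𝒱 be a finite set of nodes, 𝒩 a finite set of (unordered) node pairs, and ℒ ⊆ ℤ a finite ordered label set. Let f_p : ℒ → ℝ be arbitrary unary potentials for each p ∈ 𝒱, let g : [0,∞) → ℝ be a convex function, and for each (p,q) ∈ 𝒩 let h_{pq} : D → ℝ be a concave function on a set D ⊆ ℝ containing the range of g on the relevant label differences. Define the energy E(x) = ∑_{p∈𝒱} f_p(x_p) + ∑_{(p,q)∈𝒩} h_{pq}(g(|x_p − x_q|)) for labelings x : 𝒱 → ℒ. Given a labeling x^t, choose for each (p,q) a supergradient w_{pq} of h_{pq} at g(|x_p^t − x_q^t|). If a labeling x^{t+1} satisfies ∑_{p∈𝒱} f_p(x_p^{t+1}) + ∑_{(p,q)∈𝒩} w_{pq}·g(|x_p^{t+1} − x_q^{t+1}|) ≤ ∑_{p∈𝒱} f_p(x_p^t) + ∑_{(p,q)∈𝒩} w_{pq}·g(|x_p^t − x_q^t|) (in particular if x^{t+1} globally minimizes the weighted surrogate energy), then E(x^{t+1}) ≤ E(x^t). -/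
/-- Per-iteration energy-decrease guarantee of IRGC: for the MRF energy
`E x = ∑_p f p (x p) + ∑_{(p,q) ∈ N} h pq (g |x p - x q|)` with convex `g` on `[0,∞)` and
concave `h pq` on `D` (containing the values of `g` at the relevant label differences),
if `w pq` is a supergradient of `h pq` at `g |xt p - xt q|` and the labeling `xt1` does not
increase the weighted surrogate energy, then `E xt1 ≤ E xt`. -/
theorem stmt_15 {V : Type*} [Fintype V] (L : Finset ℤ) (N : Finset (V × V))
    (f : V → ℤ → ℝ)
    (g : ℝ → ℝ) (hg : ConvexOn ℝ (Set.Ici 0) g)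
    (D : Set ℝ)
    (hD : ∀ a ∈ L, ∀ b ∈ L, g |(a : ℝ) - (b : ℝ)| ∈ D)
    (h : V × V → ℝ → ℝ) (hconc : ∀ pq ∈ N, ConcaveOn ℝ D (h pq))
    (xt xt1 : V → ℤ) (hxt : ∀ p, xt p ∈ L) (hxt1 : ∀ p, xt1 p ∈ L)
    (w : V × V → ℝ)
    (hw : ∀ pq ∈ N, ∀ d ∈ D,
      h pq d ≤ h pq (g |(xt pq.1 : ℝ) - (xt pq.2 : ℝ)|) +
        (d - g |(xt pq.1 : ℝ) - (xt pq.2 : ℝ)|) * w pq)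
    (hsur : ∑ p, f p (xt1 p) + ∑ pq ∈ N, w pq * g |(xt1 pq.1 : ℝ) - (xt1 pq.2 : ℝ)| ≤
            ∑ p, f p (xt p) + ∑ pq ∈ N, w pq * g |(xt pq.1 : ℝ) - (xt pq.2 : ℝ)|) :
    ∑ p, f p (xt1 p) + ∑ pq ∈ N, h pq (g |(xt1 pq.1 : ℝ) - (xt1 pq.2 : ℝ)|) ≤
      ∑ p, f p (xt p) + ∑ pq ∈ N, h pq (g |(xt pq.1 : ℝ) - (xt pq.2 : ℝ)|) := by
  have hsum := Finset.sum_le_sum fun pq hpq =>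
    hw pq hpq _ (hD _ (hxt1 pq.1) _ (hxt1 pq.2))
  simp only [mul_sub, Finset.sum_add_distrib, Finset.sum_sub_distrib, mul_comm _ (w _)] at hsum
  linarith
end
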